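/- For all integers n > k ≥ 0 and all real B ≥ 2, there exist at most c(n,k)·B^{(n+1)(n-k)/n} linear subvarieties of dimension k in P^n_Q whose union contains all rational points of P^n_Q of height ≤ B, for some constant c depending only on n and k. -/

import Mathlib

/-- A point of `ℙ^n(ℚ)` has height `≤ B` if it admits homogeneous integer
coordinates all of absolute value `≤ B`. -/
def HeightLe (n : ℕ) (B : ℝ) (p : Projectivization ℚ (Fin (n + 1) → ℚ)) : Prop :=
  ∃ (v : Fin (n + 1) → ℤ) (hv : (fun i => (v i : ℚ)) ≠ 0),
    Projectivization.mk ℚ (fun i => (v i : ℚ)) hv = p ∧ ∀ i, |(v i : ℝ)| ≤ B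

section PlaneCover

open Finset

/-- The sup norm of an integer vector, as a natural number. -/
def supNatAbs {ι : Type*} [Fintype ι] (x : ι → ℤ) : ℕ := univ.sup fun i => (x i).natAbs

lemma supNatAbs_le {ι : Type*} [Fintype ι] {x : ι → ℤ} {r : ℕ} :
    supNatAbs x ≤ r ↔ ∀ i, (x i).natAbs ≤ r := by
  simp [supNatAbs]

lemma natAbs_le_supNatAbs {ι : Type*} [Fintype ι] (x : ι → ℤ) (i : ι) :
    (x i).natAbs ≤ supNatAbs x := supNatAbs_le.1 le_rfl i

lemma supNatAbs_eq_zero {ι : Type*} [Fintype ι] {x : ι → ℤ} : supNatAbs x = 0 ↔ x = 0 := by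
  rw [← Nat.le_zero, supNatAbs_le]
  simp [funext_iff]

/-- A subspace of dimension `d` has `d` coordinates which control all the others, with a constant
depending only on `d`. -/
lemma Submodule.exists_dominating_coordinates {ι : Type*} [Finite ι] (d : ℕ) :
    ∀ W : Submodule ℚ (ι → ℚ), Module.finrank ℚ W = d →
      ∃ s : Fin d → ι, ∀ x ∈ W, ∀ M : ℚ, 0 ≤ M → (∀ i, |x (s i)| ≤ M) →
        ∀ t, |x t| ≤ 3 ^ d * M := by
  induction d with
  | zero =>
    intro W hW
    rw [Submodule.finrank_eq_zero] at hW
    subst hW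
    refine ⟨Fin.elim0, fun x hx M hM _ t => ?_⟩
    rw [Submodule.mem_bot] at hx
    simpa [hx] using hM
  | succ d ih =>
    intro W hW
    have : W ≠ ⊥ := by rintro rfl; simp at hW
    obtain ⟨w, hwW, hw⟩ := Submodule.exists_mem_ne_zero_of_ne_bot this
    obtain ⟨t₀, ht₀⟩ : ∃ t, w t ≠ 0 := by simpa [funext_iff] using hw
    have : Nonempty ι := ⟨t₀⟩
    obtain ⟨m, hm⟩ := Finite.exists_max fun t => |w t|
    have hm0 : 0 < |w m| := (abs_pos.2 ht₀).trans_le (hm t₀)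
    set u : ι → ℚ := (w m)⁻¹ • w with hu
    have huW : u ∈ W := W.smul_mem _ hwW
    have hum : u m = 1 := by simp [hu, abs_pos.1 hm0]
    have hu1 : ∀ t, |u t| ≤ 1 := fun t => by
      simp only [hu, Pi.smul_apply, smul_eq_mul, abs_mul, abs_inv]
      rw [inv_mul_le_one₀ hm0]
      exact hm t
    let φ : W →ₗ[ℚ] ℚ := (LinearMap.proj m).comp W.subtype
    have hφ : Function.Surjective φ := fun c => ⟨c • ⟨u, huW⟩, by simp [φ, hum]⟩
    have hrank := φ.finrank_range_add_finrank_ker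
    rw [LinearMap.range_eq_top.2 hφ, finrank_top, Module.finrank_self, hW] at hrank
    obtain ⟨s, hs⟩ := ih ((LinearMap.ker φ).map W.subtype) (by
      rw [Submodule.finrank_map_subtype_eq]
      omega)
    refine ⟨Fin.cons m s, fun x hx M hM h t => ?_⟩
    have hxm : |x m| ≤ M := by simpa using h 0
    have key := hs (x - x m • u) ⟨⟨x, hx⟩ - x m • ⟨u, huW⟩, by simp [φ, hum], rfl⟩ (2 * M)
      (by positivity) (fun i => by
        have h1 : |x (s i)| ≤ M := by simpa using h i.succ
        calc |x (s i) - x m * u (s i)| ≤ |x (s i)| + |x m * u (s i)| := abs_sub _ _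
          _ = |x (s i)| + |x m| * |u (s i)| := by rw [abs_mul]
          _ ≤ M + M * 1 := by gcongr; exact hu1 _
          _ = 2 * M := by ring) t
    have h2 : |x m * u t| ≤ M := by
      rw [abs_mul]
      calc |x m| * |u t| ≤ M * 1 := by gcongr; exact hu1 t
        _ = M := mul_one M
    have h3 : (1 : ℚ) ≤ 3 ^ d := one_le_pow₀ (by norm_num)
    calc |x t| = |(x - x m • u) t + x m * u t| := by simp
      _ ≤ |(x - x m • u) t| + |x m * u t| := abs_add_le _ _
      _ ≤ 3 ^ d * (2 * M) + 3 ^ d * M := by gcongr; nlinarith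
      _ = 3 ^ (d + 1) * M := by ring

lemma mul_card_le_of_fiberwise {G β : Type*} [AddGroup G] [DecidableEq β] {Q : G → Prop}
    {P K : ℕ} (hQ : ∀ F : Finset G, (∀ y ∈ F, Q y) → P * #F ≤ K) (S : Finset G) (f : G → β)
    (t : Finset β) (hf : ∀ x ∈ S, f x ∈ t) (hS : ∀ x ∈ S, ∀ y ∈ S, f x = f y → Q (x - y)) :
    P * #S ≤ K * #t := by
  rw [card_eq_sum_card_fiberwise hf, mul_sum, mul_comm K, ← smul_eq_mul, ← sum_const]
  refine sum_le_sum fun b _ => ?_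
  obtain h | ⟨x₀, hx₀⟩ := ({x ∈ S | f x = b}).eq_empty_or_nonempty
  · simp [h]
  rw [← card_map (Equiv.subRight x₀).toEmbedding]
  refine hQ _ fun y hy => ?_
  simp only [mem_map, mem_filter] at hy hx₀
  obtain ⟨x, ⟨hx, hxb⟩, rfl⟩ := hy
  exact hS x hx x₀ hx₀.1 (hxb.trans hx₀.2.symm)

/-- The integer vectors of sup norm at most `r`. -/
noncomputable def supNatAbsBall (ι : Type*) [Fintype ι] [DecidableEq ι] (r : ℕ) : Finset (ι → ℤ) :=
  Fintype.piFinset fun _ => Icc (-(r : ℤ)) r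

lemma mem_supNatAbsBall {ι : Type*} [Fintype ι] [DecidableEq ι] {r : ℕ} {x : ι → ℤ} :
    x ∈ supNatAbsBall ι r ↔ supNatAbs x ≤ r := by
  simp only [supNatAbsBall, Fintype.mem_piFinset, mem_Icc, supNatAbs_le]
  exact forall_congr' fun i => by omega

lemma card_supNatAbsBall (n r : ℕ) : #(supNatAbsBall (Fin n) r) = (2 * r + 1) ^ n := by
  simp only [supNatAbsBall, Fintype.card_piFinset, Int.card_Icc, prod_const, card_univ,
    Fintype.card_fin]
  congr 1
  omega

lemma card_le_of_supNatAbs_eq (n l : ℕ) (hl : 1 ≤ l) (S : Finset (Fin (n + 1) → ℤ))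
    (hS : ∀ x ∈ S, supNatAbs x = l) : #S ≤ 2 * (n + 1) * 3 ^ n * l ^ n := by
  obtain ⟨l, rfl⟩ := Nat.exists_eq_add_of_le' hl
  have hsub : S ⊆ supNatAbsBall _ (l + 1) \ supNatAbsBall _ l := fun x hx => by
    simp only [mem_sdiff, mem_supNatAbsBall, hS x hx]; omega
  have h1 := card_le_card hsub
  rw [card_sdiff_of_subset (fun x hx => by rw [mem_supNatAbsBall] at hx ⊢; omega),
    card_supNatAbsBall, card_supNatAbsBall] at h1
  have h2 := abs_pow_sub_pow_le (2 * (l + 1 : ℤ) + 1) (2 * l + 1) (n + 1)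
  rw [max_eq_left (by rw [abs_of_nonneg (by positivity), abs_of_nonneg (by positivity)]; omega),
    abs_of_nonneg (by positivity : 0 ≤ 2 * (l + 1 : ℤ) + 1)] at h2
  replace h2 := (le_abs_self _).trans h2
  have h3 : #S ≤ 2 * (n + 1) * (2 * (l + 1) + 1) ^ n := by
    refine h1.trans ?_
    rw [tsub_le_iff_left]
    zify
    have : |2 * (l + 1 : ℤ) + 1 - (2 * l + 1)| = 2 := by
      rw [show 2 * (l + 1 : ℤ) + 1 - (2 * l + 1) = 2 by ring]; rfl
    rw [this] at h2
    simp only [Nat.add_sub_cancel, Nat.cast_add, Nat.cast_one] at h2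
    linarith
  calc #S ≤ 2 * (n + 1) * (2 * (l + 1) + 1) ^ n := h3
    _ ≤ 2 * (n + 1) * (3 * (l + 1)) ^ n := by gcongr; omega
    _ = _ := by rw [mul_pow]; ring

/-- An integer vector, viewed as a rational vector. -/
abbrev ratVec {ι : Type*} (x : ι → ℤ) : ι → ℚ := fun i => (x i : ℚ)

/-- The vectors `a` are linearly independent vectors of the lattice of integer vectors orthogonal to
`v`, at most as long as any vector of that lattice outside their span, and the number of vectors of
that lattice of length at most `ρ` in their span is of the expected order `ρ ^ j / ∏ i, ‖a i‖`. -/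
structure IsGreedyReduced {n j : ℕ} (v : Fin (n + 1) → ℤ) (C : ℕ) (a : Fin j → Fin (n + 1) → ℤ) :
    Prop where
  dotProduct_eq_zero : ∀ i, a i ⬝ᵥ v = 0
  linearIndependent : LinearIndependent ℚ fun i => ratVec (a i)
  le_supNatAbs : ∀ x, x ⬝ᵥ v = 0 → ratVec x ∉ Submodule.span ℚ (Set.range fun i => ratVec (a i)) →
    ∀ i, supNatAbs (a i) ≤ supNatAbs x
  prod_mul_card_le : ∀ (ρ : ℕ), (∀ i, supNatAbs (a i) ≤ ρ) → ∀ S : Finset (Fin (n + 1) → ℤ),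
    (∀ x ∈ S, x ⬝ᵥ v = 0 ∧ ratVec x ∈ Submodule.span ℚ (Set.range fun i => ratVec (a i)) ∧
      supNatAbs x ≤ ρ) → (∏ i, supNatAbs (a i)) * #S ≤ C * ρ ^ j

lemma exists_shortest_notMem_span {n j : ℕ} (hj : j < n) (v : Fin (n + 1) → ℤ)
    (a : Fin j → Fin (n + 1) → ℚ) :
    ∃ b : Fin (n + 1) → ℤ, b ⬝ᵥ v = 0 ∧ ratVec b ∉ Submodule.span ℚ (Set.range a) ∧
      ∀ x, x ⬝ᵥ v = 0 → ratVec x ∉ Submodule.span ℚ (Set.range a) →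
        supNatAbs b ≤ supNatAbs x := by
  suffices h : {x : Fin (n + 1) → ℤ |
      x ⬝ᵥ v = 0 ∧ ratVec x ∉ Submodule.span ℚ (Set.range a)}.Nonempty by
    obtain ⟨b, hb, hmin⟩ := (measure supNatAbs).wf.has_min _ h
    exact ⟨b, hb.1, hb.2, fun x hx hx' => not_lt.1 (hmin x ⟨hx, hx'⟩)⟩
  by_contra! hne
  let φ : (Fin (n + 1) → ℚ) →ₗ[ℚ] ℚ := dotProductBilin ℚ ℚ (ratVec v)
  have hφ : ∀ x, φ x = ratVec v ⬝ᵥ x := fun x => rfl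
  have hle : LinearMap.ker φ ≤ Submodule.span ℚ (Set.range a) := by
    intro x hx
    rw [LinearMap.mem_ker, hφ] at hx
    obtain ⟨c, hc⟩ := IsLocalization.exist_integer_multiples_of_finite (nonZeroDivisors ℤ) x
    choose y hy using hc
    have hc0 : ((c : ℤ) : ℚ) ≠ 0 := by exact_mod_cast nonZeroDivisors.ne_zero c.2
    have hyx : ratVec y = ((c : ℤ) : ℚ) • x := by
      ext i
      simpa using hy i
    have hyv : y ⬝ᵥ v = 0 := by
      have : ratVec v ⬝ᵥ ratVec y = 0 := by rw [hyx, dotProduct_smul, hx, smul_zero]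
      rw [dotProduct_comm]
      simp only [dotProduct] at this ⊢
      exact_mod_cast this
    have hy' : ratVec y ∈ Submodule.span ℚ (Set.range a) := by
      by_contra h
      exact (Set.eq_empty_iff_forall_notMem.1 hne y) ⟨hyv, h⟩
    rw [hyx] at hy'
    exact (Submodule.smul_mem_iff _ hc0).1 hy'
  have h1 := Submodule.finrank_mono hle
  have h2 := finrank_range_le_card (R := ℚ) a
  rw [Set.finrank, Fintype.card_fin] at h2
  have h3 := φ.finrank_range_add_finrank_ker
  have h4 := Submodule.finrank_le (LinearMap.range φ)
  rw [Module.finrank_self] at h4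
  rw [Module.finrank_fin_fun] at h3
  omega

lemma isGreedyReduced_elim0 {n : ℕ} (v : Fin (n + 1) → ℤ) : IsGreedyReduced v 1 Fin.elim0 where
  dotProduct_eq_zero i := i.elim0
  linearIndependent := linearIndependent_empty_type
  le_supNatAbs _ _ _ i := i.elim0
  prod_mul_card_le ρ _ S hS := by
    have : S ⊆ {0} := fun x hx => by
      have := (hS x hx).2.1
      rw [Set.range_eq_empty, Submodule.span_empty, Submodule.mem_bot] at this
      rw [mem_singleton]
      ext i
      exact Int.cast_eq_zero.1 (congrFun this i)
    simpa using card_le_card this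

/-- If the integers `x` and `y` of absolute value at most `ρ` lie in the same cell of length `q`,
they differ by less than `q`. -/
lemma abs_sub_lt_of_add_div_eq {ρ q : ℕ} (hq : 0 < q) {x y : ℤ} (hx : x.natAbs ≤ ρ)
    (hy : y.natAbs ≤ ρ) (h : (x + ρ).toNat / q = (y + ρ).toNat / q) : |x - y| ≤ (q - 1 : ℕ) := by
  have h1 := Nat.div_add_mod (x + ρ).toNat q
  have h2 := Nat.div_add_mod (y + ρ).toNat q
  have h3 := Nat.mod_lt (x + ρ).toNat hq
  have h4 := Nat.mod_lt (y + ρ).toNat hq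
  rw [h] at h1
  rw [abs_le]
  omega

namespace IsGreedyReduced

variable {n j C : ℕ} {v : Fin (n + 1) → ℤ} {a : Fin j → Fin (n + 1) → ℤ} {b : Fin (n + 1) → ℤ}

/-- Finite sets of integer vectors are bounded by covering them by classes in which differences are
short vectors of the lattice. -/
lemma prod_mul_card_le_of_fiberwise (ha : IsGreedyReduced v C a) (hbv : b ⬝ᵥ v = 0)
    (hb : ratVec b ∉ Submodule.span ℚ (Set.range fun i => ratVec (a i)))
    (hmin : ∀ x, x ⬝ᵥ v = 0 → ratVec x ∉ Submodule.span ℚ (Set.range fun i => ratVec (a i)) →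
      supNatAbs b ≤ supNatAbs x) {β : Type*} (S : Finset (Fin (n + 1) → ℤ))
    (f : (Fin (n + 1) → ℤ) → β) (t : Finset β) (hf : ∀ x ∈ S, f x ∈ t)
    (hS : ∀ x ∈ S, ∀ y ∈ S, f x = f y → (x - y) ⬝ᵥ v = 0 ∧ supNatAbs (x - y) < supNatAbs b) :
    (∏ i, supNatAbs (a i)) * #S ≤ C * supNatAbs b ^ j * #t := by
  classical
  refine mul_card_le_of_fiberwise (ha.prod_mul_card_le _ (ha.le_supNatAbs b hbv hb)) S f t hf
    fun x hx y hy hxy => ?_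
  obtain ⟨h1, h2⟩ := hS x hx y hy hxy
  refine ⟨h1, ?_, h2.le⟩
  by_contra h
  exact h2.not_ge (hmin _ h1 h)

lemma cons (ha : IsGreedyReduced v C a) (hbv : b ⬝ᵥ v = 0)
    (hb : ratVec b ∉ Submodule.span ℚ (Set.range fun i => ratVec (a i)))
    (hmin : ∀ x, x ⬝ᵥ v = 0 → ratVec x ∉ Submodule.span ℚ (Set.range fun i => ratVec (a i)) →
      supNatAbs b ≤ supNatAbs x) :
    IsGreedyReduced v (C * (3 ^ (j + 2)) ^ (j + 1))
      (Fin.cons b a : Fin (j + 1) → Fin (n + 1) → ℤ) := by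
  have hcons : (fun i => ratVec ((Fin.cons b a : Fin (j + 1) → Fin (n + 1) → ℤ) i)) =
      (Fin.cons (ratVec b) fun i => ratVec (a i) : Fin (j + 1) → Fin (n + 1) → ℚ) := by
    funext i
    cases i using Fin.cases <;> rfl
  have hli : LinearIndependent ℚ
      fun i => ratVec ((Fin.cons b a : Fin (j + 1) → Fin (n + 1) → ℤ) i) := by
    rw [hcons]
    exact linearIndependent_finCons.2 ⟨ha.linearIndependent, hb⟩
  refine ⟨fun i => ?_, hli, fun x hx hxs i => ?_, fun ρ hρ S hS => ?_⟩
  · cases i using Fin.cases with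
    | zero => exact hbv
    | succ i => exact ha.dotProduct_eq_zero i
  · replace hxs : ratVec x ∉ Submodule.span ℚ (Set.range fun i => ratVec (a i)) := fun h => by
      refine hxs (Submodule.span_mono ?_ h)
      rintro _ ⟨i, rfl⟩
      exact ⟨i.succ, rfl⟩
    cases i using Fin.cases with
    | zero => exact hmin x hx hxs
    | succ i => exact ha.le_supNatAbs x hx hxs i
  · have hbρ : supNatAbs b ≤ ρ := hρ 0
    have hb1 : 1 ≤ supNatAbs b := by
      rw [Nat.one_le_iff_ne_zero, Ne, supNatAbs_eq_zero]
      rintro rfl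
      exact hb (by convert Submodule.zero_mem _; ext; simp)
    obtain ⟨s, hs⟩ := Submodule.exists_dominating_coordinates (j + 1) _
      ((finrank_span_eq_card hli).trans (Fintype.card_fin _))
    set l := supNatAbs b with hl
    set q := (l - 1) / 3 ^ (j + 1) + 1 with hq
    have hq1 : 3 ^ (j + 1) * (q - 1) < l := by
      have := Nat.mul_div_le (l - 1) (3 ^ (j + 1))
      rw [hq, Nat.add_sub_cancel]
      omega
    have hq2 : l ≤ 3 ^ (j + 1) * q := by
      have := Nat.lt_mul_div_succ (l - 1) (show 0 < 3 ^ (j + 1) by positivity)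
      rw [hq]
      omega
    have key := ha.prod_mul_card_le_of_fiberwise hbv hb hmin S
      (fun x i => (x (s i) + ρ).toNat / q) (Fintype.piFinset fun _ => range (2 * ρ / q + 1))
      (fun x hx => by
        simp only [Fintype.mem_piFinset, mem_range, Nat.lt_succ_iff]
        intro i
        have := (natAbs_le_supNatAbs x (s i)).trans (hS x hx).2.2
        exact Nat.div_le_div_right (by omega))
      (fun x hx y hy hxy => by
        obtain ⟨hx1, hx2, hx3⟩ := hS x hx
        obtain ⟨hy1, hy2, hy3⟩ := hS y hy
        refine ⟨by rw [sub_dotProduct, hx1, hy1, sub_zero], ?_⟩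
        refine lt_of_le_of_lt (supNatAbs_le.2 fun t => ?_) hq1
        have h := hs (ratVec x - ratVec y) (Submodule.sub_mem _ hx2 hy2) (q - 1 : ℕ)
          (Nat.cast_nonneg _) (fun i => by
            have := abs_sub_lt_of_add_div_eq (Nat.succ_pos _) (supNatAbs_le.1 hx3 (s i))
              (supNatAbs_le.1 hy3 (s i)) (congrFun hxy i)
            simp only [Pi.sub_apply]
            exact_mod_cast this) t
        simp only [Pi.sub_apply] at h ⊢
        zify
        exact_mod_cast h)
    rw [Fintype.card_piFinset, prod_const, card_univ, Fintype.card_fin, card_range] at key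
    have hcell : l * (2 * ρ / q + 1) ≤ 3 ^ (j + 2) * ρ := by
      have h1 : q * (2 * ρ / q) ≤ 2 * ρ := Nat.mul_div_le _ _
      have h2 : 1 ≤ 3 ^ (j + 1) := Nat.one_le_pow _ _ (by norm_num)
      calc l * (2 * ρ / q + 1) = l * (2 * ρ / q) + l := by ring
        _ ≤ 3 ^ (j + 1) * q * (2 * ρ / q) + 1 * ρ := by gcongr; omega
        _ = 3 ^ (j + 1) * (q * (2 * ρ / q)) + 1 * ρ := by ring
        _ ≤ 3 ^ (j + 1) * (2 * ρ) + 3 ^ (j + 1) * ρ := by gcongr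
        _ = 3 ^ (j + 2) * ρ := by ring
    rw [Fin.prod_univ_succ]
    simp only [Fin.cons_zero, Fin.cons_succ]
    calc l * (∏ i, supNatAbs (a i)) * #S = l * ((∏ i, supNatAbs (a i)) * #S) := by ring
      _ ≤ l * (C * l ^ j * (2 * ρ / q + 1) ^ (j + 1)) := by gcongr
      _ = C * (l * (2 * ρ / q + 1)) ^ (j + 1) := by rw [mul_pow]; ring
      _ ≤ C * (3 ^ (j + 2) * ρ) ^ (j + 1) := by gcongr
      _ = _ := by rw [mul_pow]; ring

lemma prod_mul_pow_le (ha : IsGreedyReduced v C a) (hbv : b ⬝ᵥ v = 0)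
    (hb : ratVec b ∉ Submodule.span ℚ (Set.range fun i => ratVec (a i)))
    (hmin : ∀ x, x ⬝ᵥ v = 0 → ratVec x ∉ Submodule.span ℚ (Set.range fun i => ratVec (a i)) →
      supNatAbs b ≤ supNatAbs x) (hj : j ≤ n) {H : ℕ} (hH : 1 ≤ H) (hv : supNatAbs v ≤ H) :
    (∏ i, supNatAbs (a i)) * supNatAbs b ^ (n - j) ≤ C * (2 * (n + 1) + 1) * H := by
  have hb1 : 1 ≤ supNatAbs b := by
    rw [Nat.one_le_iff_ne_zero, Ne, supNatAbs_eq_zero]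
    rintro rfl
    exact hb (by convert Submodule.zero_mem _; ext; simp)
  set l := supNatAbs b with hl
  have key := ha.prod_mul_card_le_of_fiberwise hbv hb hmin
    (Fintype.piFinset fun _ => Ico (0 : ℤ) l) (fun x => x ⬝ᵥ v)
    (Icc (-((n + 1) * (l * H) : ℕ) : ℤ) ((n + 1) * (l * H) : ℕ))
    (fun x hx => by
      simp only [Fintype.mem_piFinset, mem_Ico] at hx
      rw [mem_Icc, ← abs_le]
      calc |x ⬝ᵥ v| ≤ ∑ i, |x i * v i| := abs_sum_le_sum_abs _ _
        _ ≤ ∑ i : Fin (n + 1), (l * H : ℤ) := by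
          refine sum_le_sum fun i _ => ?_
          rw [abs_mul]
          have h1 : |x i| ≤ l := by rw [abs_of_nonneg (hx i).1]; exact (hx i).2.le
          have h2 : |v i| ≤ H := by have := supNatAbs_le.1 hv i; rw [Int.abs_eq_natAbs]; omega
          gcongr
        _ = _ := by simp)
    (fun x hx y hy hxy => by
      simp only [Fintype.mem_piFinset, mem_Ico] at hx hy
      refine ⟨by rw [sub_dotProduct, sub_eq_zero]; exact hxy, ?_⟩
      suffices supNatAbs (x - y) ≤ l - 1 by omega
      refine supNatAbs_le.2 fun t => ?_
      have := hx t
      have := hy t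
      simp only [Pi.sub_apply]
      omega)
  rw [Fintype.card_piFinset, prod_const, card_univ, Fintype.card_fin, Int.card_Ico,
    Int.card_Icc] at key
  have h1 : ((((n + 1) * (l * H) : ℕ) : ℤ) + 1 - -((n + 1) * (l * H) : ℕ)).toNat ≤
      (2 * (n + 1) + 1) * (l * H) := by
    have : 1 ≤ l * H := Nat.one_le_iff_ne_zero.2 (by positivity)
    have h : (2 * (n + 1) + 1) * (l * H) = 2 * ((n + 1) * (l * H)) + l * H := by ring
    rw [h]
    generalize (n + 1) * (l * H) = m
    omega
  have h2 : ((l : ℤ) - 0).toNat = l := by simp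
  rw [h2] at key
  refine Nat.le_of_mul_le_mul_right ?_ (show 0 < l ^ (j + 1) by positivity)
  calc (∏ i, supNatAbs (a i)) * l ^ (n - j) * l ^ (j + 1)
      = (∏ i, supNatAbs (a i)) * l ^ (n + 1) := by
        rw [mul_assoc, ← pow_add]; congr 2; omega
    _ ≤ C * l ^ j * ((2 * (n + 1) + 1) * (l * H)) := key.trans (by gcongr)
    _ = _ := by ring

end IsGreedyReduced

lemma exists_isGreedyReduced (n j : ℕ) (hj : j ≤ n) :
    ∃ C : ℕ, ∀ v : Fin (n + 1) → ℤ, ∃ a : Fin j → Fin (n + 1) → ℤ, IsGreedyReduced v C a := by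
  induction j with
  | zero => exact ⟨1, fun v => ⟨_, isGreedyReduced_elim0 v⟩⟩
  | succ j ih =>
    obtain ⟨C, hC⟩ := ih (by omega)
    refine ⟨C * (3 ^ (j + 2)) ^ (j + 1), fun v => ?_⟩
    obtain ⟨a, ha⟩ := hC v
    obtain ⟨b, hbv, hb, hmin⟩ := exists_shortest_notMem_span hj v fun i => ratVec (a i)
    exact ⟨_, ha.cons hbv hb hmin⟩

lemma exists_orthogonal_tuple (n p : ℕ) (hp : p < n) :
    ∃ K : ℕ, ∀ v : Fin (n + 1) → ℤ, ∃ a : (Fin p → Fin (n + 1) → ℤ) × (Fin (n + 1) → ℤ),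
      LinearIndependent ℚ (Fin.cons (ratVec a.2) fun i => ratVec (a.1 i) :
        Fin (p + 1) → Fin (n + 1) → ℚ) ∧
      (∀ i, a.1 i ⬝ᵥ v = 0) ∧ a.2 ⬝ᵥ v = 0 ∧ (∀ i, supNatAbs (a.1 i) ≤ supNatAbs a.2) ∧
      ∀ H, 1 ≤ H → supNatAbs v ≤ H →
        (∏ i, supNatAbs (a.1 i)) * supNatAbs a.2 ^ (n - p) ≤ K * H := by
  obtain ⟨C, hC⟩ := exists_isGreedyReduced n p hp.le
  refine ⟨C * (2 * (n + 1) + 1), fun v => ?_⟩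
  obtain ⟨a, ha⟩ := hC v
  obtain ⟨b, hbv, hb, hmin⟩ := exists_shortest_notMem_span hp v fun i => ratVec (a i)
  exact ⟨(a, b), linearIndependent_finCons.2 ⟨ha.linearIndependent, hb⟩, ha.dotProduct_eq_zero, hbv,
    ha.le_supNatAbs b hbv hb, fun H hH hv => ha.prod_mul_pow_le hbv hb hmin hp.le hH hv⟩

/-- The number of tuples of integer vectors of prescribed lengths. -/
lemma card_le_of_forall_supNatAbs_eq (n p L : ℕ) (hL : 1 ≤ L) (l : Fin p → ℕ) (hl : ∀ i, 1 ≤ l i)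
    (S : Finset ((Fin p → Fin (n + 1) → ℤ) × (Fin (n + 1) → ℤ)))
    (hS : ∀ a ∈ S, (∀ i, supNatAbs (a.1 i) = l i) ∧ supNatAbs a.2 = L) :
    #S ≤ (2 * (n + 1) * 3 ^ n) ^ (p + 1) * ((∏ i, l i) * L) ^ n := by
  classical
  have hsub : S ⊆ (Fintype.piFinset fun i => S.image fun a => a.1 i) ×ˢ S.image fun a => a.2 :=
    fun a ha => mem_product.2
      ⟨Fintype.mem_piFinset.2 fun i => mem_image_of_mem _ ha, mem_image_of_mem _ ha⟩
  refine (card_le_card hsub).trans ?_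
  rw [card_product, Fintype.card_piFinset]
  calc (∏ i, #(S.image fun a => a.1 i)) * #(S.image fun a => a.2)
      ≤ (∏ i, (2 * (n + 1) * 3 ^ n * l i ^ n)) * (2 * (n + 1) * 3 ^ n * L ^ n) := by
        refine Nat.mul_le_mul (prod_le_prod' fun i _ => ?_) ?_
        · refine card_le_of_supNatAbs_eq n _ (hl i) _ fun x hx => ?_
          obtain ⟨a, ha, rfl⟩ := mem_image.1 hx
          exact (hS a ha).1 i
        · refine card_le_of_supNatAbs_eq n _ hL _ fun x hx => ?_
          obtain ⟨a, ha, rfl⟩ := mem_image.1 hx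
          exact (hS a ha).2
    _ = _ := by
        rw [prod_mul_distrib, prod_const, card_univ, Fintype.card_fin, prod_pow]
        ring

lemma card_le_of_prod_mul_le (n p L : ℕ) (hL : 1 ≤ L) {D : ℝ} (hD : 0 ≤ D)
    (S : Finset ((Fin p → Fin (n + 1) → ℤ) × (Fin (n + 1) → ℤ)))
    (hS : ∀ a ∈ S, (∀ i, 1 ≤ supNatAbs (a.1 i)) ∧ (∀ i, supNatAbs (a.1 i) ≤ L) ∧
      supNatAbs a.2 = L ∧ (((∏ i, supNatAbs (a.1 i)) * L : ℕ) : ℝ) ≤ D) :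
    (#S : ℝ) ≤ (2 * (n + 1) * 3 ^ n) ^ (p + 1) * (D ^ n * L ^ p) := by
  have hmaps : ∀ a ∈ S, (fun i => supNatAbs (a.1 i)) ∈ Fintype.piFinset fun _ : Fin p => Icc 1 L :=
    fun a ha => Fintype.mem_piFinset.2 fun i => mem_Icc.2 ⟨(hS a ha).1 i, (hS a ha).2.1 i⟩
  rw [card_eq_sum_card_fiberwise hmaps, Nat.cast_sum]
  have hfib : ∀ l ∈ Fintype.piFinset fun _ : Fin p => Icc 1 L,
      (#{a ∈ S | (fun i => supNatAbs (a.1 i)) = l} : ℝ) ≤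
        (2 * (n + 1) * 3 ^ n) ^ (p + 1) * D ^ n := by
    intro l hl
    obtain h | ⟨a₀, ha₀⟩ := ({a ∈ S | (fun i => supNatAbs (a.1 i)) = l}).eq_empty_or_nonempty
    · rw [h, card_empty, Nat.cast_zero]
      positivity
    · rw [mem_filter] at ha₀
      have hle := (hS a₀ ha₀.1).2.2.2
      have h := card_le_of_forall_supNatAbs_eq n p L hL l
        (fun i => (mem_Icc.1 (Fintype.mem_piFinset.1 hl i)).1)
        {a ∈ S | (fun i => supNatAbs (a.1 i)) = l} (fun a ha => by
          rw [mem_filter] at ha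
          exact ⟨fun i => congrFun ha.2 i, (hS a ha.1).2.2.1⟩)
      rw [← ha₀.2] at h ⊢
      calc _ ≤ (((2 * (n + 1) * 3 ^ n) ^ (p + 1) *
            ((∏ i, supNatAbs (a₀.1 i)) * L) ^ n : ℕ) : ℝ) := by exact_mod_cast h
        _ = (2 * (n + 1) * 3 ^ n) ^ (p + 1) * (((∏ i, supNatAbs (a₀.1 i)) * L : ℕ) : ℝ) ^ n := by
          push_cast; ring
        _ ≤ _ := by gcongr
  refine (sum_le_sum hfib).trans_eq ?_
  rw [sum_const, Fintype.card_piFinset, prod_const, card_univ, Fintype.card_fin, Nat.card_Icc,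
    Nat.add_sub_cancel, nsmul_eq_mul]
  push_cast
  ring

lemma card_le_of_prod_mul_pow_le (n p T : ℕ) (hp : p + 1 < n) (hT : 1 ≤ T)
    (S : Finset ((Fin p → Fin (n + 1) → ℤ) × (Fin (n + 1) → ℤ)))
    (hS : ∀ a ∈ S, (∀ i, 1 ≤ supNatAbs (a.1 i)) ∧ (∀ i, supNatAbs (a.1 i) ≤ supNatAbs a.2) ∧
      1 ≤ supNatAbs a.2 ∧ (∏ i, supNatAbs (a.1 i)) * supNatAbs a.2 ^ (n - p) ≤ T ^ n) :
    (#S : ℝ) ≤ 2 * (2 * (n + 1) * 3 ^ n) ^ (p + 1) * T ^ ((p + 1) * (n + 1)) := by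
  obtain ⟨r, hr⟩ := Nat.exists_eq_add_of_lt hp
  obtain ⟨e, he⟩ : ∃ e, n * (r + 1) = p + 2 + e := Nat.exists_eq_add_of_le (by rw [hr]; nlinarith)
  have he' : n * n = e + ((p + 1) * (n + 1) + 1) := by
    have : n * n = n * (p + 1) + n * (r + 1) := by rw [← mul_add]; congr 1
    rw [this, he]
    ring
  have hnp : n - p = r + 1 + 1 := by omega
  rw [hnp] at hS
  have hT0 : (0 : ℝ) < T := by exact_mod_cast hT
  set c : ℝ := (2 * (n + 1) * 3 ^ n) ^ (p + 1)
  have hc0 : 0 ≤ c := by positivity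
  have hTn : T ≤ T ^ n := Nat.le_self_pow (by omega) T
  have hmaps : ∀ a ∈ S, supNatAbs a.2 ∈ Ioc 0 (T ^ n) := fun a ha => by
    obtain ⟨h1, h2, h3, h4⟩ := hS a ha
    refine mem_Ioc.2 ⟨h3, le_trans ?_ h4⟩
    calc supNatAbs a.2 ≤ supNatAbs a.2 ^ (r + 1 + 1) := Nat.le_self_pow (by omega) _
      _ = 1 * supNatAbs a.2 ^ (r + 1 + 1) := (one_mul _).symm
      _ ≤ _ := by gcongr; exact Finset.one_le_prod' fun i _ => h1 i
  rw [card_eq_sum_card_fiberwise hmaps, ← sum_Ioc_consecutive _ (Nat.zero_le T) hTn, Nat.cast_add,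
    Nat.cast_sum, Nat.cast_sum]
  have hsmall : ∀ L ∈ Ioc 0 T, (#{a ∈ S | supNatAbs a.2 = L} : ℝ) ≤
      c * ((T ^ (p + 1)) ^ n * T ^ p) := by
    intro L hL
    obtain ⟨hL0, hLT⟩ := mem_Ioc.1 hL
    refine (card_le_of_prod_mul_le n p L hL0 (D := T ^ (p + 1)) (by positivity) _
      fun a ha => ?_).trans ?_
    · obtain ⟨haS, rfl⟩ := mem_filter.1 ha
      obtain ⟨h1, h2, h3, h4⟩ := hS a haS
      refine ⟨h1, h2, rfl, ?_⟩
      have : ∏ i, supNatAbs (a.1 i) ≤ T ^ p :=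
        (prod_le_pow_card _ _ _ fun i _ => (h2 i).trans hLT).trans_eq (by simp)
      rw [pow_succ]
      exact_mod_cast Nat.mul_le_mul this hLT
    · gcongr
  have hlarge : ∀ L ∈ Ioc T (T ^ n), (#{a ∈ S | supNatAbs a.2 = L} : ℝ) ≤
      c * T ^ ((p + 1) * (n + 1) + 1) * ((L : ℝ) ^ 2)⁻¹ := by
    intro L hL
    obtain ⟨hTL, hLT⟩ := mem_Ioc.1 hL
    have hL0 : (0 : ℝ) < L := by exact_mod_cast hT.trans hTL.le
    refine (card_le_of_prod_mul_le n p L (hT.trans hTL.le) (D := T ^ n / L ^ (r + 1))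
      (by positivity) _ fun a ha => ?_).trans ?_
    · obtain ⟨haS, rfl⟩ := mem_filter.1 ha
      obtain ⟨h1, h2, h3, h4⟩ := hS a haS
      refine ⟨h1, h2, rfl, ?_⟩
      rw [le_div_iff₀ (by positivity)]
      rw [pow_succ', ← mul_assoc] at h4
      exact_mod_cast h4
    · rw [mul_assoc c]
      refine mul_le_mul_of_nonneg_left ?_ hc0
      rw [div_pow, ← pow_mul, ← pow_mul, mul_comm (r + 1), he, he', ← div_eq_mul_inv,
        div_mul_eq_mul_div, div_le_div_iff₀ (by positivity) (by positivity)]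
      have : (T : ℝ) ^ e ≤ L ^ e := by gcongr
      calc (T : ℝ) ^ (e + ((p + 1) * (n + 1) + 1)) * (L : ℝ) ^ p * (L : ℝ) ^ 2
          = T ^ e * (T ^ ((p + 1) * (n + 1) + 1) * ((L : ℝ) ^ p * (L : ℝ) ^ 2)) := by
            rw [pow_add]; ring
        _ ≤ L ^ e * (T ^ ((p + 1) * (n + 1) + 1) * ((L : ℝ) ^ p * (L : ℝ) ^ 2)) := by gcongr
        _ = _ := by ring
  have hsum : ∑ L ∈ Ioc T (T ^ n), ((L : ℝ) ^ 2)⁻¹ ≤ (T : ℝ)⁻¹ :=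
    (sum_Ioc_inv_sq_le_sub (by omega) hTn).trans (sub_le_self _ (by positivity))
  calc _ ≤ ∑ L ∈ Ioc 0 T, c * ((T ^ (p + 1)) ^ n * T ^ p) +
        ∑ L ∈ Ioc T (T ^ n), c * T ^ ((p + 1) * (n + 1) + 1) * ((L : ℝ) ^ 2)⁻¹ :=
        add_le_add (sum_le_sum hsmall) (sum_le_sum hlarge)
    _ ≤ c * T ^ ((p + 1) * (n + 1)) + c * T ^ ((p + 1) * (n + 1) + 1) * (T : ℝ)⁻¹ := by
        rw [← mul_sum (Ioc T (T ^ n))]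
        refine add_le_add (le_of_eq ?_) (by gcongr)
        rw [sum_const, Nat.card_Ioc, Nat.sub_zero, nsmul_eq_mul]
        ring
    _ = 2 * c * T ^ ((p + 1) * (n + 1)) := by
        rw [pow_succ]
        field_simp
        ring

lemma finrank_ker_mulVecLin_of_linearIndependent {m n : ℕ} {a : Fin m → Fin n → ℚ}
    (ha : LinearIndependent ℚ a) :
    Module.finrank ℚ (LinearMap.ker (Matrix.of a).mulVecLin) = n - m := by
  have h1 := (Matrix.of a).mulVecLin.finrank_range_add_finrank_ker
  have h2 : (Matrix.of a).rank = m := (LinearIndependent.rank_matrix (M := Matrix.of a) ha).trans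
    (Fintype.card_fin m)
  rw [Matrix.rank] at h2
  rw [Module.finrank_fin_fun] at h1
  omega

lemma supNatAbs_le_floor {ι : Type*} [Fintype ι] {v : ι → ℤ} {B : ℝ} (hv : ∀ i, |(v i : ℝ)| ≤ B) :
    supNatAbs v ≤ ⌊B⌋₊ := by
  refine supNatAbs_le.2 fun i => Nat.le_floor ?_
  rw [Nat.cast_natAbs, Int.cast_abs]
  exact hv i

/-- Rational points of height at most `B` form a union of at most `c B ^ (n + 1)` points. -/
lemma exists_cover_by_lines (n : ℕ) (B : ℝ) (hB : 1 ≤ B) :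
    ∃ 𝒱 : Finset (Submodule ℚ (Fin (n + 1) → ℚ)),
      (∀ V ∈ 𝒱, Module.finrank ℚ V = 1) ∧ (#𝒱 : ℝ) ≤ 3 ^ (n + 1) * B ^ (n + 1) ∧
      ∀ v : Fin (n + 1) → ℤ, ratVec v ≠ 0 → (∀ i, |(v i : ℝ)| ≤ B) → ∃ V ∈ 𝒱, ratVec v ∈ V := by
  classical
  let S := (supNatAbsBall (Fin (n + 1)) ⌊B⌋₊).filter fun v => ratVec v ≠ 0
  refine ⟨S.image fun v => Submodule.span ℚ {ratVec v}, fun V hV => ?_, ?_, fun v hv0 hv => ?_⟩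
  · obtain ⟨v, hv, rfl⟩ := mem_image.1 hV
    exact finrank_span_singleton (mem_filter.1 hv).2
  · have h : #(S.image fun v => Submodule.span ℚ {ratVec v}) ≤ (2 * ⌊B⌋₊ + 1) ^ (n + 1) :=
      card_image_le.trans ((card_filter_le _ _).trans_eq (card_supNatAbsBall _ _))
    rw [← mul_pow]
    calc _ ≤ (((2 * ⌊B⌋₊ + 1) ^ (n + 1) : ℕ) : ℝ) := by exact_mod_cast h
      _ = (2 * (⌊B⌋₊ : ℝ) + 1) ^ (n + 1) := by push_cast; rfl
      _ ≤ (3 * B) ^ (n + 1) := by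
        have := Nat.floor_le (zero_le_one.trans hB)
        gcongr
        linarith
  · exact ⟨_, mem_image_of_mem _ (mem_filter.2 ⟨mem_supNatAbsBall.2 (supNatAbs_le_floor hv), hv0⟩),
      Submodule.mem_span_singleton_self _⟩

/-- Rational points of height at most `B` can be covered by `c T ^ ((p + 1) (n + 1))` planes of
codimension `p + 1`, where `T` is of order `B ^ (1 / n)`. -/
lemma exists_cover_of_codimension (n p : ℕ) (hp : p + 1 < n) :
    ∃ K : ℕ, ∀ (T : ℕ) (B : ℝ), 1 ≤ T → 1 ≤ B → K * B ≤ (T : ℝ) ^ n →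
      ∃ 𝒱 : Finset (Submodule ℚ (Fin (n + 1) → ℚ)),
        (∀ V ∈ 𝒱, Module.finrank ℚ V = n - p) ∧
        (#𝒱 : ℝ) ≤ 2 * (2 * (n + 1) * 3 ^ n) ^ (p + 1) * T ^ ((p + 1) * (n + 1)) ∧
        ∀ v : Fin (n + 1) → ℤ, (∀ i, |(v i : ℝ)| ≤ B) → ∃ V ∈ 𝒱, ratVec v ∈ V := by
  classical
  obtain ⟨K, hK⟩ := exists_orthogonal_tuple n p (by omega)
  refine ⟨K, fun T B hT hB hTB => ?_⟩
  choose a hli hav hbv hab hprod using hK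
  let ball := supNatAbsBall (Fin (n + 1)) ⌊B⌋₊
  let A : (Fin p → Fin (n + 1) → ℤ) × (Fin (n + 1) → ℤ) → Fin (p + 1) → Fin (n + 1) → ℚ :=
    fun x => Fin.cons (ratVec x.2) fun i => ratVec (x.1 i)
  have hpos : ∀ x : Fin (n + 1) → ℤ, ratVec x ≠ 0 → 1 ≤ supNatAbs x := fun x hx => by
    rw [Nat.one_le_iff_ne_zero, Ne, supNatAbs_eq_zero]
    rintro rfl
    exact hx (by ext; simp)
  refine ⟨(ball.image a).image fun x => LinearMap.ker (Matrix.of (A x)).mulVecLin,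
    fun V hV => ?_, ?_, fun v hv => ?_⟩
  · simp only [mem_image, exists_exists_and_eq_and] at hV
    obtain ⟨v, -, rfl⟩ := hV
    rw [finrank_ker_mulVecLin_of_linearIndependent (hli v)]
    omega
  · refine le_trans (by exact_mod_cast card_image_le)
      (card_le_of_prod_mul_pow_le n p T hp hT (ball.image a) fun x hx => ?_)
    obtain ⟨v, hv, rfl⟩ := mem_image.1 hx
    refine ⟨fun i => hpos _ ((hli v).ne_zero i.succ), hab v, hpos _ ((hli v).ne_zero 0),
      (hprod v _ ((Nat.one_le_floor_iff _).2 hB) (mem_supNatAbsBall.1 hv)).trans ?_⟩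
    have : (K * ⌊B⌋₊ : ℝ) ≤ T ^ n :=
      le_trans (by gcongr; exact Nat.floor_le (zero_le_one.trans hB)) hTB
    exact_mod_cast this
  · refine ⟨_, mem_image_of_mem _ (mem_image_of_mem _
      (mem_supNatAbsBall.2 (supNatAbs_le_floor hv))), ?_⟩
    have hdot : ∀ x : Fin (n + 1) → ℤ, x ⬝ᵥ v = 0 → ratVec x ⬝ᵥ ratVec v = 0 := fun x hx => by
      simp only [dotProduct] at hx ⊢
      exact_mod_cast hx
    rw [LinearMap.mem_ker]
    funext i
    cases i using Fin.cases with
    | zero => exact hdot _ (hbv v)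
    | succ i => exact hdot _ (hav v i)

end PlaneCover

/-- Lemma 3.1 (planecover): all rational points of `ℙ^n_ℚ` of height `≤ B` are
jointly contained in at most `c(n,k) B^{(n+1)(n-k)/n}` linear subvarieties of
dimension `k` (i.e. projectivizations of `(k+1)`-dimensional subspaces). -/
theorem stmt_10 (n k : ℕ) (hkn : k < n) :
    ∃ c : ℝ, 0 < c ∧ ∀ B : ℝ, 2 ≤ B →
      ∃ 𝒱 : Finset (Submodule ℚ (Fin (n + 1) → ℚ)),
        (∀ V ∈ 𝒱, Module.finrank ℚ V = k + 1) ∧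
        (𝒱.card : ℝ) ≤ c * B ^ (((n : ℝ) + 1) * ((n : ℝ) - k) / n) ∧
        ∀ v : Fin (n + 1) → ℤ, (fun i => (v i : ℚ)) ≠ 0 → (∀ i, |(v i : ℝ)| ≤ B) →
          ∃ V ∈ 𝒱, (fun i => (v i : ℚ)) ∈ V := by
  have hn : (0 : ℝ) < n := by exact_mod_cast Nat.zero_lt_of_lt hkn
  obtain rfl | hk := Nat.eq_zero_or_pos k
  · refine ⟨3 ^ (n + 1), by positivity, fun B hB => ?_⟩
    obtain ⟨𝒱, h1, h2, h3⟩ := exists_cover_by_lines n B (by linarith)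
    refine ⟨𝒱, by simpa using h1, h2.trans_eq ?_, h3⟩
    rw [Nat.cast_zero, sub_zero, mul_div_cancel_right₀ _ hn.ne', ← Real.rpow_natCast B]
    push_cast
    rfl
  obtain ⟨p, rfl⟩ := Nat.exists_eq_add_of_lt hkn
  set n := k + p + 1 with hnkp
  obtain ⟨K, hK⟩ := exists_cover_of_codimension n p (by omega)
  set M := (p + 1) * (n + 1) with hM
  refine ⟨2 * (2 * (n + 1) * 3 ^ n) ^ (p + 1) * (2 * ((K : ℝ) + 1) ^ ((1 : ℝ) / n)) ^ M,
    by positivity, fun B hB => ?_⟩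
  set X : ℝ := ((K + 1) * B) ^ ((1 : ℝ) / n) with hX
  have hX1 : 1 ≤ X := Real.one_le_rpow (by nlinarith [(Nat.cast_nonneg K : (0 : ℝ) ≤ K)])
    (by positivity)
  have hXn : X ^ n = (K + 1) * B := by
    rw [hX, ← Real.rpow_natCast, ← Real.rpow_mul (by positivity), one_div,
      inv_mul_cancel₀ hn.ne', Real.rpow_one]
  have hT : (1 : ℝ) ≤ ⌈X⌉₊ := hX1.trans (Nat.le_ceil X)
  obtain ⟨𝒱, h1, h2, h3⟩ := hK ⌈X⌉₊ B (by exact_mod_cast hT) (by linarith) (by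
    calc (K : ℝ) * B ≤ X ^ n := by rw [hXn]; nlinarith
      _ ≤ _ := by gcongr; exact Nat.le_ceil X)
  refine ⟨𝒱, fun V hV => by rw [h1 V hV]; omega, h2.trans ?_, fun v _ hv => h3 v hv⟩
  have hTX : (⌈X⌉₊ : ℝ) ≤ 2 * X := by
    have := Nat.ceil_lt_add_one (zero_le_one.trans hX1)
    linarith
  calc _ ≤ 2 * (2 * ((n : ℝ) + 1) * 3 ^ n) ^ (p + 1) * (2 * X) ^ M := by gcongr
    _ = _ := by
      rw [hX, Real.mul_rpow (by positivity) (by positivity), ← mul_assoc 2, mul_pow _ (B ^ _),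
        ← mul_assoc, ← Real.rpow_natCast (B ^ _), ← Real.rpow_mul (by positivity)]
      congr 2
      rw [hM, hnkp]
      push_cast
      field_simp
      ring
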